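/- arXiv:1811.10675 — 2 statements merged into one kernel-verified Lean document; each statement's English description precedes it below -/
import Mathlib

section
/- If a group G is residually p-finite for infinitely many primes p, then G is bi-orderable. -/
/-- A group is bi-orderable if it admits a strict total order invariant under
both left and right multiplication. -/
def BiOrderable (G : Type*) [Group G] : Prop :=
  ∃ r : G → G → Prop, IsStrictTotalOrder G r ∧
    (∀ f g h : G, r g h → r (f * g) (f * h)) ∧
    (∀ f g h : G, r g h → r (g * f) (h * f))

/-- `G` is residually `p`-finite: every nonidentity element survives in some
finite `p`-group quotient. -/
def ResiduallyPFinite (p : ℕ) (G : Type*) [Group G] : Prop :=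
  ∀ g : G, g ≠ 1 → ∃ (K : Subgroup G) (hK : K.Normal), g ∉ K ∧
    Finite (G ⧸ K) ∧ @IsPGroup p (G ⧸ K) (@QuotientGroup.Quotient.group G _ K hK)

/-- Simultaneous approximation modulo `p`: finitely many residues have a common nonzero multiple
making all of them small in absolute value. -/
theorem exists_mul_modEq_small {ι : Type*} (F : Finset ι) {M p : ℕ} (hM : 0 < M)
    (hp : M ^ F.card < p) (c : ι → ℤ) :
    ∃ (k : ℤ) (d : ι → ℤ), k ≠ 0 ∧ |k| < p ∧
      ∀ i ∈ F, (p : ℤ) ∣ d i - k * c i ∧ M * |d i| < p := by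
  classical
  have hp0 : (0 : ℤ) < p := by exact_mod_cast lt_of_le_of_lt (Nat.zero_le _) hp
  have hM0 : (0 : ℤ) < M := by exact_mod_cast hM
  let e : ℕ → ι → ℤ := fun k i => (k * c i) % p
  have he0 : ∀ k i, 0 ≤ e k i := fun k i => Int.emod_nonneg _ hp0.ne'
  have hep : ∀ k i, e k i < p := fun k i => Int.emod_lt_of_pos _ hp0
  have hbox : ∀ k i, (e k i * M / p).toNat < M := by
    intro k i
    have h1 : e k i * M / p < M := by
      apply Int.ediv_lt_of_lt_mul hp0
      nlinarith [hep k i]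
    omega
  let f : Fin p → F → Fin M := fun k i => ⟨(e k i * M / p).toNat, hbox k i⟩
  obtain ⟨k, l, hkl, hf⟩ := Fintype.exists_ne_map_eq_of_card_lt f (by simpa using hp)
  refine ⟨(k : ℤ) - l, fun i => e k i - e l i, ?_, ?_, fun i hi => ⟨?_, ?_⟩⟩
  · have : (k : ℕ) ≠ l := fun h => hkl (Fin.ext h)
    omega
  · rw [abs_lt]
    have := k.2
    have := l.2
    omega
  · have h1 := Int.mul_ediv_add_emod ((k : ℕ) * c i) p
    have h2 := Int.mul_ediv_add_emod ((l : ℕ) * c i) p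
    refine ⟨(l : ℕ) * c i / p - (k : ℕ) * c i / p, ?_⟩
    simp only [e]
    linear_combination h1 - h2
  · have h1 : (e k i * M / p).toNat = (e l i * M / p).toNat :=
      congrArg Fin.val (congrFun hf ⟨i, hi⟩)
    have hk : 0 ≤ e k i * M / p := Int.ediv_nonneg (mul_nonneg (he0 _ _) hM0.le) hp0.le
    have hl : 0 ≤ e l i * M / p := Int.ediv_nonneg (mul_nonneg (he0 _ _) hM0.le) hp0.le
    have h2 : e k i * M / p = e l i * M / p := by omega
    have h3 := Int.mul_ediv_add_emod (e k i * M) p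
    have h4 := Int.mul_ediv_add_emod (e l i * M) p
    have h5 := Int.emod_nonneg (e k i * M) hp0.ne'
    have h6 := Int.emod_nonneg (e l i * M) hp0.ne'
    have h7 := Int.emod_lt_of_pos (e k i * M) hp0
    have h8 := Int.emod_lt_of_pos (e l i * M) hp0
    rw [h2] at h3
    have h9 : |(M : ℤ) * (e k i - e l i)| < p := by
      rw [abs_lt]
      constructor <;> linarith
    rwa [abs_mul, abs_of_pos hM0] at h9

theorem List.sum_le_length_mul {α : Type*} (f : α → ℤ) (M p : ℤ) (L : List α)
    (h : ∀ x ∈ L, M * f x ≤ p) : M * (L.map f).sum ≤ L.length * p := by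
  induction L with
  | nil => simp
  | cons x L ih =>
    have h1 := h x (by simp)
    have h2 := ih fun y hy => h y (by simp [hy])
    simp only [List.map_cons, List.sum_cons, List.length_cons]
    push_cast
    linarith

/-- Finitely many residues modulo a large prime can be given signs so that short sums of the signed
residues do not vanish. -/
theorem exists_signs_sum_not_dvd {ι : Type*} (F : Finset ι) (N : ℕ) {p : ℕ} (hpp : p.Prime)
    (hp : (N + 1) ^ F.card < p) (c : ι → ℤ) :
    ∃ s : ι → ℤˣ, ∀ L : List ι, L.length ≤ N → (∀ i ∈ L, i ∈ F) →
      (∃ i ∈ L, ¬ (p : ℤ) ∣ c i) → ¬ (p : ℤ) ∣ (L.map fun i => (s i : ℤ) * c i).sum := by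
  obtain ⟨k, d, hk0, hkp, hd⟩ := exists_mul_modEq_small F N.succ_pos hp c
  have hpk : ¬ (p : ℤ) ∣ k := fun h => hk0 (Int.eq_zero_of_abs_lt_dvd h hkp)
  have hpI : Prime (p : ℤ) := Nat.prime_iff_prime_int.mp hpp
  have hp0 : (0 : ℤ) < p := by exact_mod_cast hpp.pos
  refine ⟨fun i => if 0 ≤ d i then 1 else -1, fun L hLN hLF ⟨i, hiL, hi⟩ hdvd => ?_⟩
  have hsd : ∀ i, ((if 0 ≤ d i then 1 else -1 : ℤˣ) : ℤ) * d i = |d i| := by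
    intro i
    split_ifs with h
    · simp [abs_of_nonneg h]
    · simp [abs_of_neg (not_le.mp h)]
  have hcong : ∀ L : List ι, (∀ i ∈ L, i ∈ F) → (p : ℤ) ∣ (L.map fun i => |d i|).sum -
      k * (L.map fun i => ((if 0 ≤ d i then 1 else -1 : ℤˣ) : ℤ) * c i).sum := by
    intro L hL
    induction L with
    | nil => simp
    | cons j L ih =>
      have h1 := ih fun i hi => hL i (by simp [hi])
      have h2 := (hd j (hL j (by simp))).1
      simp only [List.map_cons, List.sum_cons]
      rw [← hsd j]
      refine (dvd_add (h2.mul_left ((if 0 ≤ d j then 1 else -1 : ℤˣ) : ℤ)) h1).trans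
        (dvd_of_eq ?_)
      ring
  have hdvd' : (p : ℤ) ∣ (L.map fun i => |d i|).sum := by
    have := dvd_add (hcong L hLF) (hdvd.mul_left k)
    simpa using this
  have hdi : d i ≠ 0 := by
    intro h0
    have := (hd i (hLF i hiL)).1
    rw [h0, zero_sub, dvd_neg] at this
    exact (hpI.dvd_or_dvd this).elim hpk hi
  have hpos : 0 < (L.map fun i => |d i|).sum := by
    have h1 : |d i| ≤ (L.map fun i => |d i|).sum :=
      List.single_le_sum (by simp) _ (List.mem_map.mpr ⟨i, hiL, rfl⟩)
    exact (abs_pos.mpr hdi).trans_le h1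
  have hle := List.sum_le_length_mul (fun i => |d i|) ((N + 1 : ℕ) : ℤ) p L
    fun j hj => (hd j (hLF j hj)).2.le
  have hge := Int.le_of_dvd hpos hdvd'
  have hLN' : (L.length : ℤ) ≤ N := by exact_mod_cast hLN
  push_cast at hle
  nlinarith

/-- The product of the conjugates of `a i ^ s i` by `q`, for `(i, q)` in the list `L`. -/
def conjProd {ι Q : Type*} [Group Q] (a : ι → Q) (s : ι → ℤˣ) (L : List (ι × Q)) : Q :=
  (L.map fun x => x.2 * a x.1 ^ (s x.1 : ℤ) * x.2⁻¹).prod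

theorem map_conjProd {ι Q R : Type*} [Group Q] [Group R] (φ : Q →* R) (a : ι → Q) (s : ι → ℤˣ)
    (L : List (ι × Q)) :
    φ (conjProd a s L) = conjProd (fun i => φ (a i)) s (L.map (Prod.map id φ)) := by
  simp [conjProd, map_list_prod, Function.comp_def]

theorem conjProd_append {ι Q : Type*} [Group Q] (a : ι → Q) (s : ι → ℤˣ) (L L' : List (ι × Q)) :
    conjProd a s (L ++ L') = conjProd a s L * conjProd a s L' := by
  simp [conjProd]

theorem conj_conjProd {ι Q : Type*} [Group Q] (a : ι → Q) (s : ι → ℤˣ) (g : Q)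
    (L : List (ι × Q)) :
    g * conjProd a s L * g⁻¹ = conjProd a s (L.map (Prod.map id (g * ·))) := by
  induction L with
  | nil => simp [conjProd]
  | cons x L ih =>
    simp only [conjProd, List.map_cons, List.prod_cons] at ih ⊢
    rw [← ih]
    simp only [Prod.map_fst, Prod.map_snd, id]
    group

/-- Elements of a finite `p`-group with `p` large can be given signs so that short products of
conjugates of the signed elements are nontrivial. -/
theorem IsPGroup.exists_signs_conjProd_ne_one {ι : Type*} (F : Finset ι) (N : ℕ) {p : ℕ}
    (hpp : p.Prime) (hp : (N + 1) ^ F.card < p) (n : ℕ) :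
    ∀ {Q : Type*} [Group Q] [Finite Q], Nat.card Q = n → IsPGroup p Q → ∀ a : ι → Q,
    ∃ s : ι → ℤˣ, ∀ L : List (ι × Q), L.length ≤ N → (∀ x ∈ L, x.1 ∈ F) →
      (∃ x ∈ L, a x.1 ≠ 1) → conjProd a s L ≠ 1 := by
  induction n using Nat.strong_induction_on with
  | _ n ih =>
  intro Q _ _ hn hQ a
  have : Fact p.Prime := ⟨hpp⟩
  rcases subsingleton_or_nontrivial Q with hQ1 | hQ1
  · exact ⟨1, fun L _ _ ⟨x, _, hx⟩ => (hx (Subsingleton.elim _ _)).elim⟩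
  have hZ := hQ.center_nontrivial
  have hpZ : p ∣ Nat.card (Subgroup.center Q) := by
    obtain ⟨k, hk⟩ := IsPGroup.iff_card.mp (hQ.to_subgroup (Subgroup.center Q))
    have : 1 < Nat.card (Subgroup.center Q) := Finite.one_lt_card
    rw [hk] at this ⊢
    exact dvd_pow_self p (by rintro rfl; simp at this)
  obtain ⟨⟨z, hzc⟩, hz⟩ := exists_prime_orderOf_dvd_card' p hpZ
  rw [Subgroup.orderOf_mk] at hz
  have hcomm : ∀ (m : ℤ) (q : Q), q * z ^ m * q⁻¹ = z ^ m := fun m q => by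
    rw [Subgroup.mem_center_iff.mp (zpow_mem hzc m) q, mul_inv_cancel_right]
  have hnormal : (Subgroup.zpowers z).Normal := ⟨by
    rintro _ ⟨m, rfl⟩ q
    exact ⟨m, (hcomm m q).symm⟩⟩
  have hcard : Nat.card (Q ⧸ Subgroup.zpowers z) < n := by
    have h1 := Subgroup.card_eq_card_quotient_mul_card_subgroup (Subgroup.zpowers z)
    rw [Nat.card_zpowers, hz, hn] at h1
    have h2 : 0 < Nat.card (Q ⧸ Subgroup.zpowers z) := Nat.card_pos
    have := hpp.two_le
    nlinarith
  obtain ⟨s, hs⟩ := ih _ hcard rfl (hQ.to_quotient (Subgroup.zpowers z))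
    fun i => QuotientGroup.mk' (Subgroup.zpowers z) (a i)
  have hc : ∀ i, ∃ m : ℤ, a i ∈ Subgroup.zpowers z → z ^ m = a i := fun i => by
    by_cases h : a i ∈ Subgroup.zpowers z
    · exact h.imp fun m hm _ => hm
    · exact ⟨0, fun h' => (h h').elim⟩
  choose c hc using hc
  obtain ⟨t, ht⟩ := exists_signs_sum_not_dvd F N hpp hp c
  classical
  refine ⟨fun i => if a i ∈ Subgroup.zpowers z then t i else s i, fun L hLN hLF hL => ?_⟩
  by_cases hLZ : ∀ x ∈ L, a x.1 ∈ Subgroup.zpowers z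
  · have hprod : ∀ L : List (ι × Q), (∀ x ∈ L, a x.1 ∈ Subgroup.zpowers z) →
        conjProd a (fun i => if a i ∈ Subgroup.zpowers z then t i else s i) L =
          z ^ ((L.map Prod.fst).map fun i => (t i : ℤ) * c i).sum := by
      intro L hL
      induction L with
      | nil => simp [conjProd]
      | cons x L ihL =>
        have h1 := ihL fun y hy => hL y (by simp [hy])
        have h2 := hL x (by simp)
        simp only [conjProd, List.map_cons, List.prod_cons, List.sum_cons] at h1 ⊢
        rw [h1, if_pos h2, zpow_add, ← hc x.1 h2, ← zpow_mul, hcomm, mul_comm (c x.1)]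
    rw [hprod L hLZ, Ne, ← orderOf_dvd_iff_zpow_eq_one, hz]
    refine ht _ (by simpa using hLN) (by simpa using fun i q h => hLF (i, q) h) ?_
    obtain ⟨x, hxL, hx⟩ := hL
    refine ⟨x.1, List.mem_map_of_mem hxL, fun h => hx ?_⟩
    rwa [← hc x.1 (hLZ x hxL), ← orderOf_dvd_iff_zpow_eq_one, hz]
  · push Not at hLZ
    obtain ⟨x, hxL, hx⟩ := hLZ
    intro h1
    have h2 := congrArg (QuotientGroup.mk' (Subgroup.zpowers z)) h1
    rw [map_conjProd, map_one] at h2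
    refine hs (L.map (Prod.map id (QuotientGroup.mk' (Subgroup.zpowers z)))) (by simpa using hLN)
      ?_ ⟨_, List.mem_map_of_mem hxL, by simpa using hx⟩ ?_
    · intro y hy
      obtain ⟨w, hw, rfl⟩ := List.mem_map.mp hy
      exact hLF w hw
    · rw [← h2]
      unfold conjProd
      congr 1
      refine List.map_congr_left fun y _ => ?_
      by_cases hy : a y.1 ∈ Subgroup.zpowers z
      · have : QuotientGroup.mk' (Subgroup.zpowers z) (a y.1) = 1 := by simpa using hy
        simp only [this, one_zpow]
      · simp only [if_neg hy]

/-- A residually `p`-finite group maps to a finite `p`-group so that finitely many given nonidentity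
elements survive. -/
theorem ResiduallyPFinite.exists_hom.{u} {p : ℕ} [Fact p.Prime] {G : Type u} [Group G]
    (h : ResiduallyPFinite p G) (F : Finset G) (hF : (1 : G) ∉ F) :
    ∃ (Q : Type u) (_ : Group Q) (_ : Finite Q) (φ : G →* Q), IsPGroup p Q ∧
      ∀ g ∈ F, φ g ≠ 1 := by
  choose K hK hgK hfin hpK using fun g : F => h g (fun h1 => hF (h1 ▸ g.2))
  refine ⟨∀ g : F, G ⧸ K g, inferInstance, inferInstance,
    MonoidHom.pi fun g => QuotientGroup.mk' (K g), ?_, fun g hg h1 => hgK ⟨g, hg⟩ ?_⟩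
  · choose n hn using fun g => IsPGroup.iff_card.mp (hpK g)
    refine IsPGroup.of_card (n := ∑ g, n g) ?_
    rw [Nat.card_pi, ← Finset.prod_pow_eq_pow_sum]
    exact Finset.prod_congr rfl fun g _ => hn g
  · simpa using congrFun h1 ⟨g, hg⟩

/-- A choice of signs for which no nonempty product of conjugates of signed nonidentity elements is
trivial gives a bi-ordering. -/
theorem biOrderable_of_signs {G : Type*} [Group G] (s : G → ℤˣ)
    (hs : ∀ L : List (G × G), L ≠ [] → (∀ x ∈ L, x.1 ≠ 1) → conjProd id s L ≠ 1) :
    BiOrderable G := by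
  let P : Set G := {g | ∃ L : List (G × G), L ≠ [] ∧ (∀ x ∈ L, x.1 ≠ 1) ∧ conjProd id s L = g}
  have hP1 : (1 : G) ∉ P := fun ⟨L, h1, h2, h3⟩ => hs L h1 h2 h3
  have hPmul : ∀ {g h}, g ∈ P → h ∈ P → g * h ∈ P := by
    rintro _ _ ⟨L, h1, h2, rfl⟩ ⟨L', h1', h2', rfl⟩
    refine ⟨L ++ L', by simp [h1], fun x hx => ?_, conjProd_append _ _ _ _⟩
    exact (List.mem_append.mp hx).elim (h2 x) (h2' x)
  have hPconj : ∀ {g} (f : G), g ∈ P → f * g * f⁻¹ ∈ P := by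
    rintro _ f ⟨L, h1, h2, rfl⟩
    refine ⟨_, by simpa using h1, fun x hx => ?_, (conj_conjProd _ _ _ _).symm⟩
    obtain ⟨y, hy, rfl⟩ := List.mem_map.mp hx
    exact h2 y hy
  have hPtot : ∀ {g : G}, g ≠ 1 → g ∈ P ∨ g⁻¹ ∈ P := by
    intro g hg
    have hmem : g ^ (s g : ℤ) ∈ P := ⟨[(g, 1)], by simp, by simpa using hg, by simp [conjProd]⟩
    rcases Int.units_eq_one_or (s g) with h | h
    · left; simpa [h] using hmem
    · right; simpa [h] using hmem
  refine ⟨fun g h => g⁻¹ * h ∈ P, ?_, fun f g h hr => ?_, fun f g h hr => ?_⟩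
  · refine
      { trichotomous := fun g h h1 h2 => ?_
        irrefl := fun g => ?_
        trans := fun f g h h1 h2 => ?_ }
    · by_contra hne
      have := hPtot (g := g⁻¹ * h) (fun h => hne (inv_mul_eq_one.mp h))
      rw [mul_inv_rev, inv_inv] at this
      exact this.elim h1 h2
    · simpa using hP1
    · simpa [mul_assoc] using hPmul h1 h2
  · simpa [mul_assoc] using hr
  · simpa [mul_assoc] using hPconj f⁻¹ hr

/-- (Rhemtulla) A group residually `p`-finite for infinitely many primes `p`
is bi-orderable. -/
theorem biOrderable_of_residually_p_finite {G : Type*} [Group G]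
    (h : {p : ℕ | p.Prime ∧ ResiduallyPFinite p G}.Infinite) : BiOrderable G := by
  classical
  let I := {L : List (G × G) // L ≠ [] ∧ ∀ x ∈ L, x.1 ≠ 1}
  let C : I → Set (G → ℤˣ) := fun L => {s | conjProd id s L.1 ≠ 1}
  have hclosed : ∀ L, IsClosed (C L) := by
    intro L
    let _ : TopologicalSpace G := ⊥
    have : DiscreteTopology G := ⟨rfl⟩
    have hcont : Continuous fun s : G → ℤˣ => conjProd id s L.1 :=
      continuous_list_prod _ fun x _ =>
        (continuous_of_discreteTopology (f := fun u : ℤˣ => x.2 * id x.1 ^ (u : ℤ) * x.2⁻¹)).comp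
          (continuous_apply x.1)
    exact (isClosed_discrete {g : G | g ≠ 1}).preimage hcont
  have hfinite : ∀ T : Finset I, (⋂ L ∈ T, C L).Nonempty := by
    intro T
    let F : Finset G := T.biUnion fun L => (L.1.map Prod.fst).toFinset
    let N : ℕ := T.sup fun L => L.1.length
    have hF : (1 : G) ∉ F := by
      intro h1
      obtain ⟨L, -, hL⟩ := Finset.mem_biUnion.mp h1
      obtain ⟨x, hx, hx1⟩ := List.mem_map.mp (List.mem_toFinset.mp hL)
      exact L.2.2 x hx hx1
    obtain ⟨p, ⟨hpp, hres⟩, hp⟩ := h.exists_gt ((N + 1) ^ F.card)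
    have : Fact p.Prime := ⟨hpp⟩
    obtain ⟨Q, _, _, φ, hQ, hφ⟩ := hres.exists_hom F hF
    obtain ⟨s, hs⟩ := IsPGroup.exists_signs_conjProd_ne_one F N hpp hp _ rfl hQ φ
    refine ⟨s, Set.mem_iInter₂.mpr fun L hLT h1 => ?_⟩
    have hLF : ∀ x ∈ L.1, x.1 ∈ F := fun x hx =>
      Finset.mem_biUnion.mpr ⟨L, hLT, List.mem_toFinset.mpr (List.mem_map_of_mem hx)⟩
    have h2 := congrArg φ h1
    rw [map_conjProd, map_one] at h2
    refine hs _ ?_ ?_ ?_ h2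
    · simpa using Finset.le_sup (f := fun L : I => L.1.length) hLT
    · intro y hy
      obtain ⟨x, hx, rfl⟩ := List.mem_map.mp hy
      exact hLF x hx
    · obtain ⟨x, hx⟩ := List.exists_mem_of_ne_nil _ L.2.1
      exact ⟨_, List.mem_map_of_mem hx, hφ x.1 (hLF x hx)⟩
  obtain ⟨s, hs⟩ := CompactSpace.iInter_nonempty hclosed hfinite
  exact biOrderable_of_signs s fun L h1 h2 => Set.mem_iInter.mp hs ⟨L, h1, h2⟩
end

section
/- If G and H are countable amenable left-orderable groups, then the free product G * H admits a recurrent left-ordering. -/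
/-- A group is left-orderable if it admits a strict total order invariant under
left multiplication. -/
def LeftOrderable (G : Type*) [Group G] : Prop :=
  ∃ r : G → G → Prop, IsStrictTotalOrder G r ∧ ∀ f g h : G, r g h → r (f * g) (f * h)

/-- `P` is the positive cone of a left-ordering of `G`. -/
def IsLeftOrderCone {G : Type*} [Group G] (P : Set G) : Prop :=
  (∀ a ∈ P, ∀ b ∈ P, a * b ∈ P) ∧ (1 : G) ∉ P ∧ ∀ g : G, g ≠ 1 → (g ∈ P ∨ g⁻¹ ∈ P)

/-- A positive cone is recurrent if positivity of any finite set of positive elements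
recurs along an increasing sequence of conjugating powers of any group element. -/
def IsRecurrentCone {G : Type*} [Group G] (P : Set G) : Prop :=
  ∀ (g : G) (s : Finset G), ↑s ⊆ P →
    ∃ n : ℕ → ℕ, StrictMono n ∧ (∀ k, 0 < n k) ∧
      ∀ k, ∀ x ∈ s, g ^ n k * x * (g ^ n k)⁻¹ ∈ P

/-- A group admits a recurrent left-ordering. -/
def RecurrentOrderable (G : Type*) [Group G] : Prop :=
  ∃ P : Set G, IsLeftOrderCone P ∧ IsRecurrentCone P

/-- A group is amenable if it admits a left-invariant finitely additive
probability measure defined on all subsets. -/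
def IsAmenable (G : Type*) [Group G] : Prop :=
  ∃ μ : Set G → ℝ, μ Set.univ = 1 ∧ (∀ A, 0 ≤ μ A) ∧
    (∀ A B, Disjoint A B → μ (A ∪ B) = μ A + μ B) ∧
    ∀ (g : G) (A : Set G), μ ((fun x => g * x) '' A) = μ A

open Filter

/-- `μ` is a left-invariant finitely additive probability measure on all subsets of `G`. -/
structure IsInvariantMean {G : Type*} [Group G] (μ : Set G → ℝ) : Prop where
  univ : μ Set.univ = 1
  nonneg : ∀ A, 0 ≤ μ A
  union : ∀ A B, Disjoint A B → μ (A ∪ B) = μ A + μ B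
  image_mul_left : ∀ (g : G) (A : Set G), μ ((fun x => g * x) '' A) = μ A

lemma IsAmenable.exists_isInvariantMean {G : Type*} [Group G] (h : IsAmenable G) :
    ∃ μ : Set G → ℝ, IsInvariantMean μ :=
  let ⟨μ, h₁, h₂, h₃, h₄⟩ := h
  ⟨μ, h₁, h₂, h₃, h₄⟩

namespace IsInvariantMean

variable {G : Type*} [Group G] {μ : Set G → ℝ}

lemma empty (hμ : IsInvariantMean μ) : μ ∅ = 0 := by
  simpa using hμ.union ∅ ∅ (by simp)

lemma mono (hμ : IsInvariantMean μ) {A B : Set G} (h : A ⊆ B) : μ A ≤ μ B := by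
  have := hμ.union A (B \ A) Set.disjoint_sdiff_right
  rw [Set.union_sdiff_cancel h] at this
  linarith [hμ.nonneg (B \ A)]

lemma le_one (hμ : IsInvariantMean μ) (A : Set G) : μ A ≤ 1 :=
  hμ.univ ▸ hμ.mono (Set.subset_univ A)

lemma union_le (hμ : IsInvariantMean μ) (A B : Set G) : μ (A ∪ B) ≤ μ A + μ B := by
  have := hμ.union A (B \ A) Set.disjoint_sdiff_right
  rw [Set.union_sdiff_self] at this
  linarith [hμ.mono (Set.sdiff_subset : B \ A ⊆ B)]

lemma biUnion_le (hμ : IsInvariantMean μ) {ι : Type*} (s : Finset ι) (B : ι → Set G) :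
    μ (⋃ i ∈ s, B i) ≤ ∑ i ∈ s, μ (B i) := by
  classical
  induction s using Finset.induction_on with
  | empty => simp [hμ.empty]
  | insert a s ha ih =>
    rw [Finset.set_biUnion_insert, Finset.sum_insert ha]
    linarith [hμ.union_le (B a) (⋃ i ∈ s, B i)]

lemma biUnion (hμ : IsInvariantMean μ) {ι : Type*} (s : Finset ι) (B : ι → Set G)
    (hB : (s : Set ι).PairwiseDisjoint B) :
    μ (⋃ i ∈ s, B i) = ∑ i ∈ s, μ (B i) := by
  classical
  induction s using Finset.induction_on with
  | empty => simp [hμ.empty]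
  | insert a s ha ih =>
    rw [Finset.set_biUnion_insert, Finset.sum_insert ha, hμ.union,
      ih (hB.subset (by simp))]
    rw [Set.disjoint_iUnion₂_right]
    intro i hi
    exact hB (by simp) (by simp [hi]) (by rintro rfl; exact ha hi)

/-- A quantitative form of Poincaré recurrence: a set of points not returning to it at the
times `1, …, M` has small measure. -/
lemma mul_le_one_of_wandering (hμ : IsInvariantMean μ) {B : Set G} {t : G} {M : ℕ}
    (hB : ∀ a ∈ B, ∀ j, 1 ≤ j → j ≤ M → (t ^ j)⁻¹ * a ∉ B) : (M + 1) * μ B ≤ 1 := by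
  have hd : ((Finset.range (M + 1) : Finset ℕ) : Set ℕ).PairwiseDisjoint
      (fun j => (fun x => t ^ j * x) '' B) := by
    have key : ∀ i j, i < j → j < M + 1 →
        Disjoint ((fun x => t ^ i * x) '' B) ((fun x => t ^ j * x) '' B) := by
      intro i j hij hj
      rw [Set.disjoint_left]
      rintro _ ⟨a, ha, rfl⟩ ⟨b, hb, hab⟩
      refine hB a ha (j - i) (by omega) (by omega) ?_
      convert hb
      have : t ^ j = t ^ i * t ^ (j - i) := by rw [← pow_add]; congr 1; omega
      simp only [this, mul_assoc] at hab
      rw [← mul_left_cancel hab, inv_mul_cancel_left]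
    intro i hi j hj hij
    simp only [Finset.coe_range, Set.mem_Iio] at hi hj
    rcases lt_or_gt_of_ne hij with h | h
    · exact key i j h hj
    · exact (key j i h hi).symm
  have h := hμ.biUnion _ _ hd
  simp only [hμ.image_mul_left, Finset.sum_const, Finset.card_range, nsmul_eq_mul] at h
  push_cast at h
  exact h ▸ hμ.le_one _

end IsInvariantMean

/-- The conjugate by `γ` of a subset of a group. -/
def conjCone {Γ : Type*} [Group Γ] (P : Set Γ) (γ : Γ) : Set Γ := {x | γ⁻¹ * x * γ ∈ P}

lemma IsLeftOrderCone.conjCone {Γ : Type*} [Group Γ] {P : Set Γ} (hP : IsLeftOrderCone P)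
    (γ : Γ) : IsLeftOrderCone (conjCone P γ) := by
  refine ⟨fun a ha b hb => ?_, fun h => hP.2.1 (by simpa [_root_.conjCone] using h),
    fun g hg => ?_⟩
  · have := hP.1 _ ha _ hb
    simpa [_root_.conjCone, mul_assoc] using this
  · have := hP.2.2 (γ⁻¹ * g * γ) (by
      intro h
      apply hg
      simpa [mul_assoc] using congrArg (γ * · * γ⁻¹) h)
    simpa [_root_.conjCone, mul_assoc] using this

/-- The limit of a sequence of positive cones along an ultrafilter is a positive cone. -/
lemma IsLeftOrderCone.ultrafilter_limit {Γ : Type*} [Group Γ] {C : ℕ → Set Γ}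
    (hC : ∀ K, IsLeftOrderCone (C K)) (U : Ultrafilter ℕ) :
    IsLeftOrderCone {x | ∀ᶠ K in U, x ∈ C K} := by
  refine ⟨fun a ha b hb => ?_, fun h => ?_, fun g hg => ?_⟩
  · filter_upwards [ha, hb] with K h₁ h₂ using (hC K).1 a h₁ b h₂
  · obtain ⟨K, hK⟩ := h.exists
    exact (hC K).2.1 hK
  · exact Ultrafilter.eventually_or.1 (Eventually.of_forall fun K => (hC K).2.2 g hg)

/-- If a positive cone is invariant under conjugation by the kernel of a surjection onto an
amenable group, then some limit of its conjugates is recurrent. -/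
theorem recurrentOrderable_of_amenable_quotient {Γ A : Type*} [Group Γ] [Group A] [Countable Γ]
    (π : Γ →* A) (hπ : Function.Surjective π) (hA : IsAmenable A) {P₀ : Set Γ}
    (hP₀ : IsLeftOrderCone P₀) (hinv : ∀ n, π n = 1 → ∀ x ∈ P₀, n * x * n⁻¹ ∈ P₀) :
    RecurrentOrderable Γ := by
  obtain ⟨μ, hμ⟩ := hA.exists_isInvariantMean
  have hconj : ∀ γ γ' x, π γ = π γ' → x ∈ conjCone P₀ γ → x ∈ conjCone P₀ γ' := by
    intro γ γ' x h hx
    have := hinv (γ'⁻¹ * γ) (by simp [h]) _ hx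
    simpa [conjCone, mul_assoc] using this
  obtain ⟨σ, hσ⟩ := hπ.hasRightInverse
  obtain ⟨e, he⟩ := exists_surjective_nat (Γ × Finset Γ × ℕ)
  let C : A → Set Γ := fun a => conjCone P₀ (σ a)
  have hCmul : ∀ (g x : Γ) (a : A), g * x * g⁻¹ ∈ C a ↔ x ∈ C ((π g)⁻¹ * a) := by
    intro g x a
    have h₁ : g * x * g⁻¹ ∈ C a ↔ x ∈ conjCone P₀ (g⁻¹ * σ a) := by
      simp [C, conjCone, mul_assoc]
    rw [h₁]
    constructor <;> apply hconj <;> simp [hσ _]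
  let bad : ℕ → Set (Set Γ) := fun k => {P | ↑(e k).2.1 ⊆ P ∧
    ∀ j, 1 ≤ j → j ≤ 2 ^ (k + 2) → ∃ x ∈ (e k).2.1,
      ((e k).1 ^ ((e k).2.2 + 1)) ^ j * x * (((e k).1 ^ ((e k).2.2 + 1)) ^ j)⁻¹ ∉ P}
  have hbad : ∀ k, μ (C ⁻¹' bad k) ≤ (1 / 2) ^ (k + 2) := by
    intro k
    have := hμ.mul_le_one_of_wandering (B := C ⁻¹' bad k)
      (t := π ((e k).1 ^ ((e k).2.2 + 1))) (M := 2 ^ (k + 2)) (by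
        rintro a ⟨-, ha⟩ j h1 h2 ⟨hs, -⟩
        obtain ⟨x, hx, hxP⟩ := ha j h1 h2
        rw [hCmul, map_pow] at hxP
        exact hxP (hs hx))
    rw [one_div, inv_pow, ← one_div, le_div_iff₀ (by positivity)]
    push_cast at this
    nlinarith [hμ.nonneg (C ⁻¹' bad k)]
  have hex : ∀ K, ∃ a, ∀ k < K, C a ∉ bad k := by
    intro K
    by_contra! h
    have hU : (⋃ k ∈ Finset.range K, C ⁻¹' bad k) = Set.univ := by
      ext a
      obtain ⟨k, hk, hk'⟩ := h a
      simp only [Set.mem_iUnion, Set.mem_univ, iff_true, Finset.mem_range]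
      exact ⟨k, hk, hk'⟩
    have h1 := hμ.biUnion_le (Finset.range K) (fun k => C ⁻¹' bad k)
    rw [hU, hμ.univ] at h1
    have h2 : ∑ k ∈ Finset.range K, (1 / 2 : ℝ) ^ (k + 2) = 1 / 2 - (1 / 2) ^ (K + 1) := by
      clear h hU h1
      induction K with
      | zero => norm_num
      | succ n ih => rw [Finset.sum_range_succ, ih]; ring
    have h3 := Finset.sum_le_sum (fun k (_ : k ∈ Finset.range K) => hbad k)
    have : (0 : ℝ) < (1 / 2) ^ (K + 1) := by positivity
    linarith
  choose a ha using hex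
  let U : Ultrafilter ℕ := hyperfilter ℕ
  let P : Set Γ := {x | ∀ᶠ K in U, x ∈ C (a K)}
  have hPbad : ∀ k, P ∉ bad k := by
    rintro k ⟨hs, hj⟩
    have e1 : ∀ᶠ K in (U : Filter ℕ), ∀ x ∈ (e k).2.1, x ∈ C (a K) :=
      (Filter.eventually_all_finset _).2 fun x hx => hs hx
    have e2 : ∀ᶠ K in (U : Filter ℕ), ∀ j ∈ Finset.Icc 1 (2 ^ (k + 2)), ∃ x ∈ (e k).2.1,
        ((e k).1 ^ ((e k).2.2 + 1)) ^ j * x * (((e k).1 ^ ((e k).2.2 + 1)) ^ j)⁻¹ ∉ C (a K) := by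
      refine (Filter.eventually_all_finset _).2 fun j hjm => ?_
      rw [Finset.mem_Icc] at hjm
      obtain ⟨x, hx, hxP⟩ := hj j hjm.1 hjm.2
      filter_upwards [Ultrafilter.eventually_not.2 hxP] with K hK using ⟨x, hx, hK⟩
    have e3 : ∀ᶠ K in (U : Filter ℕ), k < K :=
      Nat.hyperfilter_le_atTop (eventually_gt_atTop k)
    obtain ⟨K, h1, h2, h3⟩ := (e1.and (e2.and e3)).exists
    exact ha K k h3 ⟨h1, fun j hj1 hj2 => h2 j (Finset.mem_Icc.2 ⟨hj1, hj2⟩)⟩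
  refine ⟨P, .ultrafilter_limit (fun K => hP₀.conjCone _) U, fun g s hs => ?_⟩
  have hfreq : ∀ N, ∃ n > N, 0 < n ∧ ∀ x ∈ s, g ^ n * x * (g ^ n)⁻¹ ∈ P := by
    intro N
    obtain ⟨k, hk⟩ := he (g, s, N)
    have h := hPbad k
    simp only [bad, hk, Set.mem_ofPred_eq, hs, true_and] at h
    push Not at h
    obtain ⟨j, hj, -, hx⟩ := h
    refine ⟨(N + 1) * j, by nlinarith, by positivity, fun x hxs => ?_⟩
    rw [pow_mul]
    exact hx x hxs
  obtain ⟨n, hn, hn'⟩ := Nat.exists_strictMono_subsequence hfreq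
  exact ⟨n, hn, fun k => (hn' k).1, fun k => (hn' k).2⟩

namespace IsInvariantMean

variable {G : Type*} [Group G] {μ : Set G → ℝ}

/-- The integral against `μ` of a function with values in `{0, …, n}`, by the layer-cake
formula. -/
def layerSum (μ : Set G → ℝ) (n : ℕ) (φ : G → ℕ) : ℝ :=
  ∑ i ∈ Finset.range n, μ {g | i < φ g}

lemma layerSum_add_indicator (hμ : IsInvariantMean μ) {n : ℕ} {φ ψ : G → ℕ} (E : Set G)
    (hψ : ∀ g, ψ g ≤ n) (hE : ∀ g ∈ E, ψ g = φ g + 1) (hE' : ∀ g ∉ E, ψ g = φ g) :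
    layerSum μ n ψ = layerSum μ n φ + μ E := by
  have hlevel : ∀ i, μ {g | i < ψ g} = μ {g | i < φ g} + μ {g | g ∈ E ∧ φ g = i} := by
    intro i
    rw [← hμ.union]
    · congr 1
      ext g
      by_cases hg : g ∈ E
      · simp only [Set.mem_ofPred_eq, Set.mem_union, hg, true_and, hE g hg]
        omega
      · simp [hg, hE' g hg]
    · rw [Set.disjoint_left]
      rintro g (h₁ : i < φ g) ⟨-, h₂⟩
      omega
  have hsum : ∀ k, ∑ i ∈ Finset.range k, μ {g | g ∈ E ∧ φ g = i} = μ {g | g ∈ E ∧ φ g < k} := by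
    intro k
    induction k with
    | zero => simp [hμ.empty]
    | succ k ih =>
      rw [Finset.sum_range_succ, ih, ← hμ.union]
      · congr 1
        ext g
        simp only [Set.mem_ofPred_eq, Set.mem_union, Nat.lt_succ_iff_lt_or_eq, and_or_left]
      · rw [Set.disjoint_left]
        rintro g ⟨-, h₁⟩ ⟨-, h₂⟩
        omega
  unfold layerSum
  rw [Finset.sum_congr rfl fun i _ => hlevel i, Finset.sum_add_distrib, hsum]
  congr 2
  ext g
  simp only [Set.mem_ofPred_eq, and_iff_left_iff_imp]
  intro hg
  have := hE g hg
  have := hψ g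
  omega

lemma layerSum_add (hμ : IsInvariantMean μ) {n : ℕ} {φ ψ : G → ℕ}
    (h : ∀ g, φ g + ψ g ≤ n) :
    layerSum μ n (fun g => φ g + ψ g) = layerSum μ n φ + layerSum μ n ψ := by
  have key : ∀ k, layerSum μ n (fun g => φ g + min (ψ g) k) =
      layerSum μ n φ + layerSum μ n (fun g => min (ψ g) k) := by
    intro k
    induction k with
    | zero => simp [layerSum, hμ.empty]
    | succ k ih =>
      rw [hμ.layerSum_add_indicator (ψ := fun g => φ g + min (ψ g) (k + 1))
          (φ := fun g => φ g + min (ψ g) k) {g | k < ψ g},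
        hμ.layerSum_add_indicator (ψ := fun g => min (ψ g) (k + 1))
          (φ := fun g => min (ψ g) k) {g | k < ψ g}, ih, add_assoc]
      all_goals
        intro g
        have := h g
        grind
  have hmin : ∀ g, min (ψ g) n = ψ g := fun g => by have := h g; omega
  simpa [hmin] using key n

variable {H : Type*} {ν : Set H → ℝ}

/-- The integral of the measures of the fibres of a subset of `G × H`, up to an error `1 / n`. -/
noncomputable def prodApprox (μ : Set G → ℝ) (ν : Set H → ℝ) (n : ℕ) (S : Set (G × H)) : ℝ :=
  layerSum μ n (fun g => ⌊n * ν {h | (g, h) ∈ S}⌋₊) / n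

lemma prodApprox_nonneg (hμ : IsInvariantMean μ) (n : ℕ) (S : Set (G × H)) :
    0 ≤ prodApprox μ ν n S :=
  div_nonneg (Finset.sum_nonneg fun _ _ => hμ.nonneg _) (by positivity)

lemma prodApprox_le_one (hμ : IsInvariantMean μ) (n : ℕ) (S : Set (G × H)) :
    prodApprox μ ν n S ≤ 1 := by
  refine div_le_one_of_le₀ ?_ (by positivity)
  exact (Finset.sum_le_sum fun _ _ => hμ.le_one _).trans (by simp)

variable [Group H]

lemma prodApprox_univ (hμ : IsInvariantMean μ) (hν : IsInvariantMean ν) {n : ℕ} (hn : 0 < n) :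
    prodApprox μ ν n Set.univ = 1 := by
  have : ∑ i ∈ Finset.range n, μ {_g | i < n} = n := by
    rw [Finset.sum_congr rfl (g := fun _ => (1 : ℝ))]
    · simp
    · intro i hi
      simp [Finset.mem_range.1 hi, hμ.univ]
  simp only [prodApprox, layerSum, Set.mem_univ, Set.ofPred_true, hν.univ, mul_one,
    Nat.floor_natCast, this]
  exact div_self (by positivity)

lemma prodApprox_image_mul_left (hμ : IsInvariantMean μ) (hν : IsInvariantMean ν) (n : ℕ)
    (p : G × H) (S : Set (G × H)) :
    prodApprox μ ν n ((fun x => p * x) '' S) = prodApprox μ ν n S := by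
  have hfib : ∀ g, ν {h | (g, h) ∈ (fun x => p * x) '' S} = ν {h | (p.1⁻¹ * g, h) ∈ S} := by
    intro g
    rw [← hν.image_mul_left p.2 {h | (p.1⁻¹ * g, h) ∈ S}]
    congr 1
    ext h
    have : p⁻¹ * (g, h) = (p.1⁻¹ * g, p.2⁻¹ * h) := rfl
    simp [Set.image_mul_left, this]
  unfold prodApprox layerSum
  congr 1
  refine Finset.sum_congr rfl fun i _ => ?_
  simp only [hfib]
  rw [← hμ.image_mul_left p.1 {g | i < ⌊n * ν {h | (g, h) ∈ S}⌋₊}]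
  congr 1
  ext g
  simp

lemma prodApprox_union (hμ : IsInvariantMean μ) (hν : IsInvariantMean ν) (n : ℕ)
    {S T : Set (G × H)} (hST : Disjoint S T) :
    prodApprox μ ν n S + prodApprox μ ν n T ≤ prodApprox μ ν n (S ∪ T) ∧
      prodApprox μ ν n (S ∪ T) ≤ prodApprox μ ν n S + prodApprox μ ν n T + 1 / n := by
  let φ : Set (G × H) → G → ℕ := fun S g => ⌊n * ν {h | (g, h) ∈ S}⌋₊
  have hfib : ∀ g, ν {h | (g, h) ∈ S ∪ T} = ν {h | (g, h) ∈ S} + ν {h | (g, h) ∈ T} := by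
    intro g
    rw [← hν.union]
    · rfl
    · rw [Set.disjoint_left]
      exact fun h h₁ h₂ => Set.disjoint_left.1 hST h₁ h₂
  have hlow : ∀ g, φ S g + φ T g ≤ φ (S ∪ T) g := by
    intro g
    simp only [φ, hfib, mul_add]
    refine Nat.le_floor ?_
    push_cast
    gcongr <;> exact Nat.floor_le (mul_nonneg (by positivity) (hν.nonneg _))
  have hupp : ∀ g, φ (S ∪ T) g ≤ φ S g + φ T g + 1 := by
    intro g
    simp only [φ, hfib, mul_add]
    rw [← Nat.lt_succ_iff, Nat.floor_lt (add_nonneg (mul_nonneg (by positivity) (hν.nonneg _))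
      (mul_nonneg (by positivity) (hν.nonneg _)))]
    push_cast
    linarith [Nat.lt_floor_add_one (n * ν {h | (g, h) ∈ S}),
      Nat.lt_floor_add_one (n * ν {h | (g, h) ∈ T})]
  have hle : ∀ g, φ (S ∪ T) g ≤ n := by
    intro g
    refine Nat.floor_le_of_le ?_
    exact mul_le_of_le_one_right (by positivity) (hν.le_one _)
  have h₁ : layerSum μ n (fun g => φ S g + φ T g) = layerSum μ n (φ S) + layerSum μ n (φ T) :=
    hμ.layerSum_add fun g => (hlow g).trans (hle g)
  have h₂ := hμ.layerSum_add_indicator (φ := fun g => φ S g + φ T g)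
    {g | φ S g + φ T g < φ (S ∪ T) g} hle
    (fun g hg => le_antisymm (hupp g) (by simpa using hg))
    (fun g hg => le_antisymm (by simpa using hg) (hlow g))
  have h₃ := hμ.nonneg {g | φ S g + φ T g < φ (S ∪ T) g}
  have h₄ := hμ.le_one {g | φ S g + φ T g < φ (S ∪ T) g}
  change layerSum μ n (φ S) / n + layerSum μ n (φ T) / n ≤ layerSum μ n (φ (S ∪ T)) / n ∧
    layerSum μ n (φ (S ∪ T)) / n ≤ layerSum μ n (φ S) / n + layerSum μ n (φ T) / n + 1 / n
  rw [← add_div, ← add_div]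
  constructor <;> gcongr <;> linarith

end IsInvariantMean

theorem IsAmenable.prod {G H : Type*} [Group G] [Group H] (hG : IsAmenable G)
    (hH : IsAmenable H) : IsAmenable (G × H) := by
  obtain ⟨μ, hμ⟩ := hG.exists_isInvariantMean
  obtain ⟨ν, hν⟩ := hH.exists_isInvariantMean
  have hlim : ∀ S : Set (G × H), ∃ m ∈ Set.Icc (0 : ℝ) 1,
      Tendsto (fun n => IsInvariantMean.prodApprox μ ν n S) (hyperfilter ℕ) (nhds m) := by
    intro S
    exact isCompact_Icc.ultrafilter_le_nhds
      ((hyperfilter ℕ).map fun n => IsInvariantMean.prodApprox μ ν n S)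
      (by
        rw [Ultrafilter.coe_map, le_principal_iff]
        exact Filter.mem_map.2 (univ_mem' fun n =>
          ⟨hμ.prodApprox_nonneg n S, hμ.prodApprox_le_one n S⟩))
  choose m hm hmlim using hlim
  refine ⟨m, ?_, fun A => (hm A).1, fun A B hAB => ?_, fun g A => ?_⟩
  · refine tendsto_nhds_unique (hmlim Set.univ) (tendsto_const_nhds.congr' ?_)
    filter_upwards [Nat.hyperfilter_le_atTop (eventually_gt_atTop 0)] with n hn
    exact (hμ.prodApprox_univ hν hn).symm
  · have h0 : Tendsto (fun n : ℕ => 1 / (n : ℝ)) (hyperfilter ℕ) (nhds 0) :=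
      tendsto_one_div_atTop_nhds_zero_nat.mono_left Nat.hyperfilter_le_atTop
    have hadd := (hmlim A).add (hmlim B)
    apply le_antisymm
    · have := le_of_tendsto_of_tendsto' (hmlim (A ∪ B)) (hadd.add h0)
        fun n => (hμ.prodApprox_union hν n hAB).2
      simpa using this
    · exact le_of_tendsto_of_tendsto' hadd (hmlim (A ∪ B))
        fun n => (hμ.prodApprox_union hν n hAB).1
  · refine tendsto_nhds_unique (hmlim _) ((hmlim A).congr fun n => ?_)
    exact (hμ.prodApprox_image_mul_left hν n g A).symm

open Polynomial Matrix

/-- Integral two-by-two matrices. -/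
abbrev Mat2 := Matrix (Fin 2) (Fin 2) ℤ

/-- The lexicographic positive cone of the additive group of integral two-by-two matrices. -/
def Mat2.Pos (m : Mat2) : Prop :=
  0 < m 0 0 ∨ m 0 0 = 0 ∧ (0 < m 0 1 ∨ m 0 1 = 0 ∧ (0 < m 1 0 ∨ m 1 0 = 0 ∧ 0 < m 1 1))

lemma Mat2.Pos.add {a b : Mat2} (ha : Mat2.Pos a) (hb : Mat2.Pos b) : Mat2.Pos (a + b) := by
  simp only [Mat2.Pos, Matrix.add_apply] at *
  omega

lemma Mat2.not_pos_zero : ¬ Mat2.Pos 0 := by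
  simp [Mat2.Pos]

lemma Mat2.pos_or_pos_neg {a : Mat2} (ha : a ≠ 0) : Mat2.Pos a ∨ Mat2.Pos (-a) := by
  by_contra! h
  apply ha
  simp only [Mat2.Pos, Matrix.neg_apply] at h
  ext i j
  fin_cases i <;> fin_cases j <;> simp <;> omega

/-- The units of `Mat2[X]` with constant term `1`. -/
abbrev MagnusGroup : Type :=
  (Units.map (constantCoeff : Mat2[X] →+* Mat2).toMonoidHom).ker

lemma MagnusGroup.coeff_zero (f : MagnusGroup) : (f : Mat2[X]ˣ).val.coeff 0 = 1 := by
  have := f.2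
  rw [MonoidHom.mem_ker, Units.ext_iff] at this
  simpa using this

/-- An element of the Magnus group is positive if its lowest nonconstant coefficient is. -/
def MagnusGroup.Pos (f : MagnusGroup) : Prop :=
  ∃ (n : ℕ) (b : Mat2[X]), (f : Mat2[X]ˣ).val = 1 + b * X ^ (n + 1) ∧ Mat2.Pos (b.coeff 0)

lemma Polynomial.exists_eq_mul_X_pow_of_ne_zero {R : Type*} [Ring R] {p : R[X]} (hp : p ≠ 0) :
    ∃ (n : ℕ) (b : R[X]), p = b * X ^ n ∧ b.coeff 0 ≠ 0 := by
  obtain ⟨b, hb⟩ : X ^ p.natTrailingDegree ∣ p :=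
    X_pow_dvd_iff.2 fun d hd => coeff_eq_zero_of_lt_natTrailingDegree hd
  refine ⟨_, b, hb.trans X_pow_mul, fun h => hp (trailingCoeff_eq_zero.1 ?_)⟩
  have := congrArg (coeff · p.natTrailingDegree) hb
  simpa [coeff_X_pow_mul', h] using this

namespace MagnusGroup

lemma Pos.mul {f g : MagnusGroup} (hf : f.Pos) (hg : g.Pos) : (f * g).Pos := by
  obtain ⟨n, b, hb, hbp⟩ := hf
  obtain ⟨m, c, hc, hcp⟩ := hg
  rcases le_total n m with h | h
  · obtain ⟨d, rfl⟩ := Nat.exists_eq_add_of_le h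
    refine ⟨n, b + c * X ^ d + b * c * X ^ (n + d + 1), ?_, ?_⟩
    · have e : b * X ^ (n + 1) * (c * X ^ (n + d + 1)) = b * c * X ^ (n + d + 1) * X ^ (n + 1) := by
        rw [mul_assoc, ← mul_assoc (X ^ _), X_pow_mul, mul_assoc c, mul_assoc, mul_assoc,
          ← pow_add, ← pow_add, add_comm]
      rw [Subgroup.coe_mul, Units.val_mul, hb, hc, add_mul, mul_add, mul_add, e]
      simp only [add_mul, mul_assoc, ← pow_add, one_mul, mul_one]
      rw [show d + (n + 1) = n + d + 1 by omega]
      abel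
    · rcases Nat.eq_zero_or_pos d with rfl | hd
      · simpa [mul_coeff_zero] using hbp.add hcp
      · simpa [mul_coeff_zero, hd.ne] using hbp
  · obtain ⟨d, rfl⟩ := Nat.exists_eq_add_of_le h
    refine ⟨m, c + b * X ^ d + b * c * X ^ (m + d + 1), ?_, ?_⟩
    · have e : b * X ^ (m + d + 1) * (c * X ^ (m + 1)) = b * c * X ^ (m + d + 1) * X ^ (m + 1) := by
        rw [mul_assoc, ← mul_assoc (X ^ _), X_pow_mul, mul_assoc c, mul_assoc, mul_assoc]
      rw [Subgroup.coe_mul, Units.val_mul, hb, hc, add_mul, mul_add, mul_add, e]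
      simp only [add_mul, mul_assoc, ← pow_add, one_mul, mul_one]
      rw [show d + (m + 1) = m + d + 1 by omega]
      abel
    · rcases Nat.eq_zero_or_pos d with rfl | hd
      · simpa [mul_coeff_zero, add_comm] using hcp.add hbp
      · simpa [mul_coeff_zero, hd.ne] using hcp

lemma not_pos_one : ¬ (1 : MagnusGroup).Pos := by
  rintro ⟨n, b, hb, hbp⟩
  have h0 : (b * X ^ (n + 1)).coeff (0 + (n + 1)) = 0 := by
    have : b * X ^ (n + 1) = 0 := by simpa using hb
    simp [this]
  rw [coeff_mul_X_pow] at h0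
  exact Mat2.not_pos_zero (h0 ▸ hbp)

lemma Pos.conj {f : MagnusGroup} (hf : f.Pos) (g : MagnusGroup) : (g * f * g⁻¹).Pos := by
  obtain ⟨n, b, hb, hbp⟩ := hf
  refine ⟨n, (g : Mat2[X]ˣ).val * b * (g⁻¹ : MagnusGroup).val.val, ?_, ?_⟩
  · have h1 : (g : Mat2[X]ˣ).val * (g⁻¹ : MagnusGroup).val.val = 1 := by
      rw [← Units.val_mul, ← Subgroup.coe_mul, mul_inv_cancel]
      rfl
    rw [Subgroup.coe_mul, Units.val_mul, Subgroup.coe_mul, Units.val_mul, hb, mul_add, add_mul,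
      mul_one, h1, mul_assoc, mul_assoc b, X_pow_mul]
    simp only [mul_assoc]
  · simpa only [mul_coeff_zero, coeff_zero, one_mul, mul_one] using hbp

lemma pos_or_pos_inv {f : MagnusGroup} (hf : f ≠ 1) : f.Pos ∨ f⁻¹.Pos := by
  have hne : (f : Mat2[X]ˣ).val - 1 ≠ 0 := fun h =>
    hf (Subtype.ext (Units.ext (sub_eq_zero.1 h)))
  obtain ⟨n, b, hb, hb0⟩ := exists_eq_mul_X_pow_of_ne_zero hne
  obtain ⟨k, rfl⟩ : ∃ k, n = k + 1 := by
    refine Nat.exists_eq_succ_of_ne_zero ?_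
    rintro rfl
    apply hb0
    rw [← mul_one b, ← pow_zero X, ← hb]
    simp [coeff_zero]
  have hfb : (f : Mat2[X]ˣ).val = 1 + b * X ^ (k + 1) := by rw [← hb]; abel
  rcases Mat2.pos_or_pos_neg hb0 with h | h
  · exact Or.inl ⟨k, b, hfb, h⟩
  · refine Or.inr ⟨k, -((f⁻¹ : MagnusGroup).val.val * b), ?_, ?_⟩
    · have h1 : (f⁻¹ : MagnusGroup).val.val * (f : Mat2[X]ˣ).val = 1 := by
        rw [← Units.val_mul, ← Subgroup.coe_mul, inv_mul_cancel]
        rfl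
      rw [neg_mul (f⁻¹.val.val * b) (X ^ (k + 1)), mul_assoc, ← hb, mul_sub, h1, mul_one]
      abel
    · simpa only [coeff_neg, mul_coeff_zero, coeff_zero, one_mul] using h

/-- The positive cone of a group extension of a left-ordered group by a subgroup of the Magnus
group. -/
lemma isLeftOrderCone_extension {Γ A : Type*} [Group Γ] [Group A] (π : Γ →* A)
    {Q : Set A} (hQ : IsLeftOrderCone Q) (c : Γ → MagnusGroup)
    (hc : ∀ x y, π x = 1 → π y = 1 → c (x * y) = c x * c y)
    (hinj : ∀ x, π x = 1 → c x = 1 → x = 1) :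
    IsLeftOrderCone {x | π x ∈ Q ∨ π x = 1 ∧ (c x).Pos} ∧
      ∀ n, π n = 1 → ∀ x ∈ {x | π x ∈ Q ∨ π x = 1 ∧ (c x).Pos},
        n * x * n⁻¹ ∈ {x | π x ∈ Q ∨ π x = 1 ∧ (c x).Pos} := by
  have hc1 : c 1 = 1 := by simpa using hc 1 1 (map_one π) (map_one π)
  have hcinv : ∀ x, π x = 1 → c x⁻¹ = (c x)⁻¹ := fun x hx => by
    rw [eq_inv_iff_mul_eq_one, ← hc _ _ (by simp [hx]) hx, inv_mul_cancel, hc1]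
  refine ⟨⟨?_, ?_, ?_⟩, ?_⟩
  · rintro a (ha | ⟨ha, ha'⟩) b (hb | ⟨hb, hb'⟩)
    · exact Or.inl (by rw [map_mul]; exact hQ.1 _ ha _ hb)
    · exact Or.inl (by rwa [map_mul, hb, mul_one])
    · exact Or.inl (by rwa [map_mul, ha, one_mul])
    · exact Or.inr ⟨by rw [map_mul, ha, hb, one_mul], hc a b ha hb ▸ ha'.mul hb'⟩
  · rintro (h | ⟨-, h⟩)
    · exact hQ.2.1 (map_one π ▸ h)
    · exact not_pos_one (hc1 ▸ h)
  · intro g hg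
    by_cases h : π g = 1
    · exact (pos_or_pos_inv fun h' => hg (hinj g h h')).imp (fun h' => Or.inr ⟨h, h'⟩)
        fun h' => Or.inr ⟨by simp [h], by rwa [hcinv g h]⟩
    · exact (hQ.2.2 _ h).imp Or.inl fun h' => Or.inl (by rwa [map_inv])
  · rintro n hn x (hx | ⟨hx, hx'⟩)
    · exact Or.inl (by simpa [hn] using hx)
    · refine Or.inr ⟨by simp [hn, hx], ?_⟩
      rw [hc _ _ (by simp [hn, hx]) (by simp [hn]), hc _ _ hn hx, hcinv n hn]
      exact hx'.conj _

/-- The rank-one matrix attached to a pair of integers; it is nilpotent when they agree. -/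
def rankOne (s t : ℤ) : Mat2 := vecMulVec ![1, s] ![-t, 1]

lemma rankOne_ne_zero (s t : ℤ) : rankOne s t ≠ 0 := by
  intro h
  have := congrFun (congrFun h 0) 1
  simp [rankOne, vecMulVec] at this

lemma rankOne_mul (s t s' t' : ℤ) : rankOne s t * rankOne s' t' = (s' - t) • rankOne s t' := by
  ext i j
  fin_cases i <;> fin_cases j <;>
    simp [rankOne, vecMulVec, Matrix.mul_apply, Fin.sum_univ_two] <;> ring

lemma C_rankOne_mul_X_mul_self (t : ℤ) :
    C (rankOne t t) * X * (C (rankOne t t) * X) = 0 := by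
  rw [mul_assoc, ← mul_assoc X, X_mul_C, ← mul_assoc, ← mul_assoc, ← C_mul, rankOne_mul]
  simp

/-- The unipotent element `1 + X N` attached to the nilpotent matrix `N = rankOne t t`. -/
noncomputable def unip (t : ℤ) : MagnusGroup :=
  ⟨⟨1 + C (rankOne t t) * X, 1 - C (rankOne t t) * X,
      by rw [mul_sub, add_mul, add_mul, C_rankOne_mul_X_mul_self]; simp,
      by rw [mul_add, sub_mul, sub_mul, C_rankOne_mul_X_mul_self]; simp⟩, by
    rw [MonoidHom.mem_ker, Units.ext_iff]
    simp⟩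

lemma coe_unip (t : ℤ) : (unip t : Mat2[X]ˣ).val = 1 + C (rankOne t t) * X := rfl

lemma coe_unip_inv (t : ℤ) : ((unip t)⁻¹ : MagnusGroup).val.val = 1 - C (rankOne t t) * X := rfl

lemma natDegree_unip_mul_unip_inv_le (s t : ℤ) :
    (unip s * (unip t)⁻¹ : MagnusGroup).val.val.natDegree ≤ 2 := by
  rw [Subgroup.coe_mul, Units.val_mul, coe_unip, coe_unip_inv]
  compute_degree

lemma coeff_two_unip_mul_unip_inv (s t : ℤ) :
    (unip s * (unip t)⁻¹ : MagnusGroup).val.val.coeff 2 = (s - t) • rankOne s t := by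
  have e : (1 + C (rankOne s s) * X) * (1 - C (rankOne t t) * X) =
      1 + C (rankOne s s) * X - C (rankOne t t) * X - C (rankOne s s * rankOne t t) * X ^ 2 := by
    have : C (rankOne s s) * X * (C (rankOne t t) * X) = C (rankOne s s * rankOne t t) * X ^ 2 := by
      rw [mul_assoc, ← mul_assoc X, X_mul_C, C_mul]
      simp only [mul_assoc, sq]
    rw [mul_sub, add_mul, add_mul, this]
    noncomm_ring
  rw [Subgroup.coe_mul, Units.val_mul, coe_unip, coe_unip_inv, e, rankOne_mul]
  simp only [coeff_sub, coeff_add, coeff_C_mul, coeff_X, coeff_X_pow, coeff_one]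
  simp [sub_mul]

end MagnusGroup

/-- Products `g₁ h₁ g₂ h₂ ⋯ gₙ hₙ` in a free product in which no factor is trivial, except
possibly the last. -/
inductive IsAlternating {G H : Type*} [Group G] [Group H] : Monoid.Coprod G H → Prop
  | single (g : G) (hg : g ≠ 1) (h : H) :
      IsAlternating (Monoid.Coprod.inl g * Monoid.Coprod.inr h)
  | cons (g : G) (hg : g ≠ 1) (h : H) (hh : h ≠ 1) (w : Monoid.Coprod G H)
      (hw : IsAlternating w) :
      IsAlternating (Monoid.Coprod.inl g * Monoid.Coprod.inr h * w)

section FreeProduct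

variable {G H : Type*} [Group G] [Group H]

open Monoid.Coprod RegularWreathProduct

lemma exists_eq_inr_mul_isAlternating (x : Monoid.Coprod G H) :
    ∃ (h : H) (w : Monoid.Coprod G H), x = inr h * w ∧ (w = 1 ∨ IsAlternating w) := by
  induction x using Monoid.Coprod.induction_on' with
  | one => exact ⟨1, 1, by simp, Or.inl rfl⟩
  | inr_mul n x ih =>
    obtain ⟨h, w, rfl, hw⟩ := ih
    exact ⟨n * h, w, by simp [mul_assoc], hw⟩
  | inl_mul m x ih =>
    by_cases hm : m = 1
    · subst hm
      simpa using ih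
    obtain ⟨h, w, rfl, rfl | hw⟩ := ih
    · exact ⟨1, _, by simp, Or.inr (.single m hm h)⟩
    · by_cases hh : h = 1
      · subst hh
        cases hw with
        | single g hg h =>
          by_cases hmg : m * g = 1
          · exact ⟨h, 1, by simp [← mul_assoc, ← map_mul, hmg], Or.inl rfl⟩
          · exact ⟨1, _, by simp [mul_assoc], Or.inr (.single _ hmg h)⟩
        | cons g hg h hh w hw =>
          by_cases hmg : m * g = 1
          · exact ⟨h, w, by simp [← mul_assoc, ← map_mul, hmg], Or.inr hw⟩
          · exact ⟨1, _, by simp [mul_assoc], Or.inr (.cons _ hmg h hh w hw)⟩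
      · exact ⟨1, _, by simp [mul_assoc], Or.inr (.cons m hm h hh w hw)⟩

/-- The representation of `G * H` in a wreath product over `G × H` that is the canonical embedding
on `H` and the canonical embedding conjugated by the function `v ↦ unip (t v)` on `G`. -/
noncomputable def magnusRep (t : G × H → ℤ) :
    Monoid.Coprod G H →* MagnusGroup ≀ᵣ (G × H) :=
  lift
    ((MulAut.conj (⟨fun v => MagnusGroup.unip (t v), 1⟩ :
      MagnusGroup ≀ᵣ (G × H))).toMonoidHom.comp (inl.comp (MonoidHom.inl G H)))
    (inl.comp (MonoidHom.inr G H))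

lemma magnusRep_inl (t : G × H → ℤ) (g : G) :
    magnusRep t (Monoid.Coprod.inl g) =
      ⟨fun v => MagnusGroup.unip (t v) * (MagnusGroup.unip (t (g⁻¹ * v.1, v.2)))⁻¹, (g, 1)⟩ := by
  ext1
  · funext v
    have : (g⁻¹, (1 : H)) * v = (g⁻¹ * v.1, v.2) := by simp [Prod.ext_iff]
    simp [magnusRep, this]
  · simp [magnusRep]

lemma magnusRep_inr (t : G × H → ℤ) (h : H) :
    magnusRep t (Monoid.Coprod.inr h) = ⟨1, (1, h)⟩ := by
  simp [magnusRep]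
  rfl

lemma magnusRep_right (t : G × H → ℤ) (x : Monoid.Coprod G H) :
    (magnusRep t x).right = toProd x := by
  have : (rightHom.comp (magnusRep t) : Monoid.Coprod G H →* G × H) = toProd := by
    ext1
    · ext1 g
      simp [magnusRep_inl]
    · ext1 h
      simp [magnusRep_inr]
  exact DFunLike.congr_fun this x

/-- The coefficient of highest degree of the cocycle of an alternating product. -/
lemma IsAlternating.exists_coeff_eq {t : G × H → ℤ} (ht : Function.Injective t)
    {w : Monoid.Coprod G H} (hw : IsAlternating w) (v : G × H) :
    ∃ (n : ℕ) (k s : ℤ), 0 < n ∧ k ≠ 0 ∧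
      ((magnusRep t w).left v).val.val.natDegree ≤ n ∧
      ((magnusRep t w).left v).val.val.coeff n = k • MagnusGroup.rankOne (t v) s := by
  induction hw generalizing v with
  | single g hg h =>
    have e : (magnusRep t (Monoid.Coprod.inl g * Monoid.Coprod.inr h)).left v =
        MagnusGroup.unip (t v) * (MagnusGroup.unip (t (g⁻¹ * v.1, v.2)))⁻¹ := by
      simp [magnusRep_inl, magnusRep_inr]
    rw [e]
    refine ⟨2, _, _, by norm_num, ?_, MagnusGroup.natDegree_unip_mul_unip_inv_le _ _,
      MagnusGroup.coeff_two_unip_mul_unip_inv _ _⟩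
    refine sub_ne_zero.2 fun h' => hg ?_
    have := congrArg Prod.fst (ht h')
    simpa using this
  | cons g hg h hh w hw ih =>
    obtain ⟨n, k, s, hn, hk, hdeg, hcoeff⟩ := ih (g⁻¹ * v.1, h⁻¹ * v.2)
    have e : (magnusRep t (Monoid.Coprod.inl g * Monoid.Coprod.inr h * w)).left v =
        MagnusGroup.unip (t v) * (MagnusGroup.unip (t (g⁻¹ * v.1, v.2)))⁻¹ *
          (magnusRep t w).left (g⁻¹ * v.1, h⁻¹ * v.2) := by
      have : (g⁻¹, h⁻¹) * v = (g⁻¹ * v.1, h⁻¹ * v.2) := rfl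
      simp [magnusRep_inl, magnusRep_inr, this]
    have h2 := MagnusGroup.natDegree_unip_mul_unip_inv_le (t v) (t (g⁻¹ * v.1, v.2))
    rw [e, Subgroup.coe_mul, Units.val_mul]
    refine ⟨2 + n, (t v - t (g⁻¹ * v.1, v.2)) * k *
      (t (g⁻¹ * v.1, h⁻¹ * v.2) - t (g⁻¹ * v.1, v.2)), s, by omega, ?_,
      natDegree_mul_le_of_le h2 hdeg, ?_⟩
    · refine mul_ne_zero (mul_ne_zero (sub_ne_zero.2 fun h' => hg ?_) hk)
        (sub_ne_zero.2 fun h' => hh ?_)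
      · simpa using congrArg Prod.fst (ht h')
      · simpa using congrArg Prod.snd (ht h')
    · rw [coeff_mul_add_eq_of_natDegree_le h2 hdeg, MagnusGroup.coeff_two_unip_mul_unip_inv, hcoeff,
        smul_mul_smul_comm, MagnusGroup.rankOne_mul, smul_smul]

lemma eq_one_of_magnusRep_left_eq_one {t : G × H → ℤ} (ht : Function.Injective t)
    {x : Monoid.Coprod G H} (hx : toProd x = 1) {v : G × H} (h : (magnusRep t x).left v = 1) :
    x = 1 := by
  obtain ⟨h₀, w, rfl, rfl | hw⟩ := exists_eq_inr_mul_isAlternating x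
  · have : h₀ = 1 := by simpa using congrArg Prod.snd hx
    simp [this]
  · exfalso
    obtain ⟨n, k, s, hn, hk, -, hcoeff⟩ := hw.exists_coeff_eq ht ((1, h₀)⁻¹ * v)
    have e : (magnusRep t w).left ((1, h₀)⁻¹ * v) = 1 := by
      simpa [magnusRep_inr] using h
    rw [e] at hcoeff
    have : (((1 : MagnusGroup).val.val : Mat2[X])).coeff n = 0 := by
      simp [coeff_one, hn.ne']
    rw [this] at hcoeff
    exact (smul_ne_zero hk (MagnusGroup.rankOne_ne_zero _ _)) hcoeff.symm

end FreeProduct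

lemma LeftOrderable.exists_isLeftOrderCone {G : Type*} [Group G] (h : LeftOrderable G) :
    ∃ P : Set G, IsLeftOrderCone P := by
  obtain ⟨r, hr, hmul⟩ := h
  refine ⟨{g | r 1 g}, fun a ha b hb => ?_, fun h => irrefl _ h, fun g hg => ?_⟩
  · have := hmul a 1 b hb
    rw [mul_one] at this
    exact _root_.trans (r := r) ha this
  · rcases trichotomous_of r 1 g with h | h | h
    · exact Or.inl h
    · exact absurd h.symm hg
    · have := hmul g⁻¹ g 1 h
      rw [inv_mul_cancel, mul_one] at this
      exact Or.inr this

lemma IsLeftOrderCone.prod {G H : Type*} [Group G] [Group H] {P : Set G} {Q : Set H}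
    (hP : IsLeftOrderCone P) (hQ : IsLeftOrderCone Q) :
    IsLeftOrderCone {x : G × H | x.1 ∈ P ∨ x.1 = 1 ∧ x.2 ∈ Q} := by
  refine ⟨?_, ?_, ?_⟩
  · rintro ⟨a, b⟩ (h | ⟨h, h'⟩) ⟨c, d⟩ (k | ⟨k, k'⟩) <;> dsimp only at *
    · exact Or.inl (hP.1 _ h _ k)
    · exact Or.inl (by simpa [k] using h)
    · exact Or.inl (by simpa [h] using k)
    · exact Or.inr ⟨by simp [h, k], hQ.1 _ h' _ k'⟩
  · rintro (h | ⟨-, h⟩)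
    · exact hP.2.1 h
    · exact hQ.2.1 h
  · rintro ⟨a, b⟩ hab
    by_cases ha : a = 1
    · have hb : b ≠ 1 := by
        rintro rfl
        exact hab (by rw [ha]; rfl)
      exact (hQ.2.2 b hb).imp (fun h => Or.inr ⟨ha, h⟩) fun h => Or.inr ⟨by simp [ha], h⟩
    · exact (hP.2.2 a ha).imp Or.inl Or.inl

/-- The free product of two countable amenable left-orderable groups admits a
recurrent left-ordering. -/
theorem recurrentOrderable_freeProd {G H : Type*} [Group G] [Group H]
    [Countable G] [Countable H]
    (hGa : IsAmenable G) (hHa : IsAmenable H)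
    (hGl : LeftOrderable G) (hHl : LeftOrderable H) :
    RecurrentOrderable (Monoid.Coprod G H) := by
  obtain ⟨P, hP⟩ := hGl.exists_isLeftOrderCone
  obtain ⟨Q, hQ⟩ := hHl.exists_isLeftOrderCone
  obtain ⟨t, ht⟩ := exists_injective_nat (G × H)
  have ht' : Function.Injective fun v => (t v : ℤ) := Nat.cast_injective.comp ht
  have : Countable (Monoid.Coprod G H) := Monoid.Coprod.mk_surjective.countable
  obtain ⟨h₁, h₂⟩ := MagnusGroup.isLeftOrderCone_extension Monoid.Coprod.toProd (hP.prod hQ)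
    (fun x => (magnusRep (fun v => (t v : ℤ)) x).left 1)
    (fun x y hx _ => by simp [magnusRep_right, hx])
    (fun x hx h => eq_one_of_magnusRep_left_eq_one ht' hx h)
  exact recurrentOrderable_of_amenable_quotient _ Monoid.Coprod.toProd_surjective
    (hGa.prod hHa) h₁ h₂
end
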